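/- arXiv:2403.00387 — 2 statements merged into one kernel-verified Lean document; each statement's English description precedes it below -/
import Mathlib

section
/- There exists a constant c > 0 such that, for every M > 0, there exists a solution X = (x, z1, z2) of the time-delay system (S_c) whose initial segment satisfies sup_{τ∈[−2,0]}|x(τ)| ≤ 1, sup_{τ∈[−2,0]}|z1(τ)| ≤ 1, z1(0) = 0, and z2(τ) = 1 for all τ ∈ [−2,−1], and whose x-component satisfies |x(1)| ≥ 2M. -/
open Set Matrix

/-- The matrix `A0`. -/
noncomputable def A0 : Matrix (Fin 2) (Fin 2) ℝ := !![-0.1, 0.5; -2, 0]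

/-- The matrix `A1`. -/
noncomputable def A1 : Matrix (Fin 2) (Fin 2) ℝ := !![0, 2; -0.5, -0.1]

/-- The saturation function `φ`. -/
noncomputable def phi (s : ℝ) : ℝ := if s < 0 then 0 else if s ≤ 1 then s else 1

/-- `ℝ²` with the Euclidean norm. -/
abbrev E2 : Type := EuclideanSpace ℝ (Fin 2)

/-- Action of a `2 × 2` matrix on `ℝ²`. -/
noncomputable def act (A : Matrix (Fin 2) (Fin 2) ℝ) (x : E2) : E2 :=
  Matrix.toEuclideanLin A x

/-- The nonlinearity `g(x,u) = (1+|x|²)(φ(u) A1 + (1-φ(u)) A0) x`. -/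
noncomputable def gfun (x : E2) (u : ℝ) : E2 :=
  (1 + ‖x‖ ^ 2) • act (phi u • A1 + (1 - phi u) • A0) x

/-- `X = (x, z1, z2) : [-2,∞) → ℝ² × ℝ × ℝ` is a solution of the time-delay system `(S_c)`. -/
def IsSolution (c : ℝ) (x : ℝ → E2) (z1 z2 : ℝ → ℝ) : Prop :=
  ContinuousOn x (Ici (-2 : ℝ)) ∧ ContinuousOn z1 (Ici (-2 : ℝ)) ∧
  ContinuousOn z2 (Ici (-2 : ℝ)) ∧
  ∀ t : ℝ, 0 < t →
    HasDerivAt x ((c * phi (z2 (t - 2))) • gfun (x t) (z1 (t - 1))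
      + (c * (1 - phi (z2 (t - 2)))) • act A0 (x t)) t
    ∧ HasDerivAt z1 (-(z1 t)) t ∧ HasDerivAt z2 (-(z2 t)) t

/-- Euclidean norm `|X(t)|` of the full state `(x(t), z1(t), z2(t)) ∈ ℝ⁴`. -/
noncomputable def Xnorm (x : ℝ → E2) (z1 z2 : ℝ → ℝ) (t : ℝ) : ℝ :=
  Real.sqrt (‖x t‖ ^ 2 + (z1 t) ^ 2 + (z2 t) ^ 2)

/-- Norm `‖X0‖ = sup_{τ ∈ [-2,0]} |X(τ)|` of the initial segment of a solution. -/
noncomputable def initNorm (x : ℝ → E2) (z1 z2 : ℝ → ℝ) : ℝ :=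
  sSup (Xnorm x z1 z2 '' Icc (-2 : ℝ) 0)

/-- The scalar autonomous equation `σ' = h(σ)` with `h` continuous, positive and bounded has a
global solution through any prescribed point. -/
lemma exists_global_solution {h : ℝ → ℝ} (hc : Continuous h) (hpos : ∀ s, 0 < h s) {H : ℝ}
    (hH : ∀ s, h s ≤ H) (t₀ s₀ : ℝ) :
    ∃ σ : ℝ → ℝ, σ t₀ = s₀ ∧ ∀ t, HasDerivAt σ (h (σ t)) t := by
  have hinv : Continuous fun s => (h s)⁻¹ := hc.inv₀ fun s => (hpos s).ne'
  set F : ℝ → ℝ := fun s => t₀ + ∫ y in s₀..s, (h y)⁻¹ with hF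
  have hFd : ∀ s, HasDerivAt F (h s)⁻¹ s := fun s =>
    (hinv.integral_hasStrictDerivAt s₀ s).hasDerivAt.const_add t₀
  have hFs : F s₀ = t₀ := by simp [hF]
  have hH0 : 0 < H := (hpos 0).trans_le (hH 0)
  have hmono : Monotone fun s => F s - H⁻¹ * s := by
    refine monotone_of_hasDerivAt_nonneg
      (fun s => (hFd s).sub ((hasDerivAt_id s).const_mul H⁻¹)) fun s => ?_
    have := inv_anti₀ (hpos s) (hH s)
    simpa using this
  have hstrict : StrictMono F := by
    intro a b hab
    have h1 := hmono hab.le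
    have h2 : H⁻¹ * a < H⁻¹ * b := mul_lt_mul_of_pos_left hab (inv_pos.2 hH0)
    simp only at h1
    linarith
  have hFc : Continuous F := continuous_iff_continuousAt.2 fun s => (hFd s).continuousAt
  have hsurj : Function.Surjective F := by
    have hlin : Filter.Tendsto (fun s : ℝ => H⁻¹ * s) Filter.atTop Filter.atTop :=
      Filter.tendsto_id.const_mul_atTop (inv_pos.2 hH0)
    have hlin' : Filter.Tendsto (fun s : ℝ => H⁻¹ * s) Filter.atBot Filter.atBot :=
      Filter.tendsto_id.const_mul_atBot (inv_pos.2 hH0)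
    refine hFc.surjective ?_ ?_
    · refine Filter.tendsto_atTop_mono' _ ?_ (Filter.tendsto_atTop_add_const_right _ (F 0) hlin)
      filter_upwards [Filter.eventually_ge_atTop 0] with s hs
      have := hmono hs
      simp only at this
      linarith
    · refine Filter.tendsto_atBot_mono' _ ?_ (Filter.tendsto_atBot_add_const_right _ (F 0) hlin')
      filter_upwards [Filter.eventually_le_atBot 0] with s hs
      have := hmono hs
      simp only at this
      linarith
  set e := hstrict.orderIsoOfSurjective F hsurj with he
  have hFe : ∀ t, F (e.symm t) = t := fun t => e.apply_symm_apply t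
  refine ⟨e.symm, ?_, fun t => ?_⟩
  · rw [OrderIso.symm_apply_eq]; exact hFs.symm
  · have := HasDerivAt.of_local_left_inverse (f := F) (g := e.symm) (a := t)
      e.symm.continuous.continuousAt (hFd _) (inv_ne_zero (hpos _).ne')
      (Filter.Eventually.of_forall hFe)
    simpa using this

/-- Radial rate `⟪B v, v⟫` of `B = u A1 + (1 - u) A0` at `v = (cos s, - sin s)`. -/
noncomputable def radialRate (u s : ℝ) : ℝ :=
  (-0.1 * (1 - u) * Real.cos s - (0.5 + 1.5 * u) * Real.sin s) * Real.cos s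
    - ((-2 + 1.5 * u) * Real.cos s + 0.1 * u * Real.sin s) * Real.sin s

/-- Clockwise angular rate of `B = u A1 + (1 - u) A0` at `v = (cos s, - sin s)`. -/
noncomputable def angularRate (u s : ℝ) : ℝ :=
  -(-0.1 * (1 - u) * Real.cos s - (0.5 + 1.5 * u) * Real.sin s) * Real.sin s
    - ((-2 + 1.5 * u) * Real.cos s + 0.1 * u * Real.sin s) * Real.cos s

lemma angularRate_ge {u : ℝ} (h0 : 0 ≤ u) (h1 : u ≤ 1) (s : ℝ) : 0.4 ≤ angularRate u s := by
  unfold angularRate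
  have h := Real.sin_sq_add_cos_sq s
  nlinarith [mul_nonneg h0 (sq_nonneg (Real.sin s)), mul_nonneg h0 (sq_nonneg (Real.cos s)),
    mul_nonneg (sub_nonneg.2 h1) (sq_nonneg (Real.sin s)),
    mul_nonneg (sub_nonneg.2 h1) (sq_nonneg (Real.cos s)),
    mul_nonneg h0 (sq_nonneg (Real.sin s - Real.cos s)),
    mul_nonneg (sub_nonneg.2 h1) (sq_nonneg (Real.sin s + Real.cos s))]

lemma angularRate_le {u : ℝ} (h0 : 0 ≤ u) (h1 : u ≤ 1) (s : ℝ) : angularRate u s ≤ 3 := by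
  unfold angularRate
  have h := Real.sin_sq_add_cos_sq s
  nlinarith [mul_nonneg h0 (sq_nonneg (Real.sin s)), mul_nonneg h0 (sq_nonneg (Real.cos s)),
    mul_nonneg (sub_nonneg.2 h1) (sq_nonneg (Real.sin s)),
    mul_nonneg (sub_nonneg.2 h1) (sq_nonneg (Real.cos s)),
    mul_nonneg h0 (sq_nonneg (Real.sin s + Real.cos s)),
    mul_nonneg (sub_nonneg.2 h1) (sq_nonneg (Real.sin s - Real.cos s))]

/-- Under the destabilizing feedback, the logarithmic growth per unit angle has positive mean. -/
lemma le_radialRate_div_angularRate (s : ℝ) :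
    0.13 - 0.22 * Real.cos (4 * s) ≤
      radialRate ((1 - Real.sin (2 * s)) / 2) s / angularRate ((1 - Real.sin (2 * s)) / 2) s := by
  have hu0 : 0 ≤ (1 - Real.sin (2 * s)) / 2 := by linarith [Real.sin_le_one (2 * s)]
  have hu1 : (1 - Real.sin (2 * s)) / 2 ≤ 1 := by linarith [Real.neg_one_le_sin (2 * s)]
  rw [le_div_iff₀ (by linarith [angularRate_ge hu0 hu1 s])]
  have h4 : Real.cos (4 * s) = 1 - 2 * Real.sin (2 * s) ^ 2 := by
    rw [show 4 * s = 2 * (2 * s) by ring, Real.cos_two_mul, Real.cos_sq']; ring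
  have hS : Real.sin s ^ 2 = (1 - Real.cos (2 * s)) / 2 := by rw [Real.sin_sq_eq_half_sub]; ring
  have hC : Real.cos s ^ 2 = (1 + Real.cos (2 * s)) / 2 := by rw [Real.cos_sq]; ring
  have hSC : Real.sin s * Real.cos s = Real.sin (2 * s) / 2 := by rw [Real.sin_two_mul]; ring
  have hq : radialRate ((1 - Real.sin (2 * s)) / 2) s =
      0.75 * Real.sin (2 * s) ^ 2 - 0.05 - 0.05 * (Real.sin (2 * s) * Real.cos (2 * s)) := by
    unfold radialRate
    linear_combination
      (-0.1 * (1 - (1 - Real.sin (2 * s)) / 2)) * hC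
        - 0.1 * ((1 - Real.sin (2 * s)) / 2) * hS
        + (1.5 - 3 * ((1 - Real.sin (2 * s)) / 2)) * hSC
  have hw : angularRate ((1 - Real.sin (2 * s)) / 2) s =
      1.25 + 0.75 * (Real.sin (2 * s) * Real.cos (2 * s)) + 0.05 * Real.sin (2 * s) ^ 2 := by
    unfold angularRate
    linear_combination
      (0.5 + 1.5 * ((1 - Real.sin (2 * s)) / 2)) * hS
        + (2 - 1.5 * ((1 - Real.sin (2 * s)) / 2)) * hC
        + (0.1 - 0.2 * ((1 - Real.sin (2 * s)) / 2)) * hSC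
  rw [hq, hw, h4]
  have h := Real.sin_sq_add_cos_sq (2 * s)
  generalize Real.sin (2 * s) = a at *
  generalize Real.cos (2 * s) = b at *
  have hab1 : a * b ≤ 1 / 2 := by nlinarith [sq_nonneg (a - b)]
  have hab2 : -(1 / 2) ≤ a * b := by nlinarith [sq_nonneg (a + b)]
  have ha : a ^ 2 ≤ 1 := by nlinarith [sq_nonneg b]
  nlinarith [mul_nonneg (sq_nonneg a) (sub_nonneg.2 hab1),
    mul_nonneg (sq_nonneg a) (sub_nonneg.2 ha), sq_nonneg a]

lemma phi_of_mem {s : ℝ} (h0 : 0 ≤ s) (h1 : s ≤ 1) : phi s = s := by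
  simp [phi, not_lt.2 h0, h1]

/-- The point of `ℝ²` at distance `r` from the origin and clockwise angle `s`. -/
noncomputable def polarPoint (r s : ℝ) : E2 := !₂[r * Real.cos s, -(r * Real.sin s)]

lemma norm_polarPoint {r : ℝ} (hr : 0 ≤ r) (s : ℝ) : ‖polarPoint r s‖ = r := by
  rw [EuclideanSpace.norm_eq, Real.sqrt_eq_iff_eq_sq (by positivity) hr]
  simp only [polarPoint, Fin.sum_univ_two, Real.norm_eq_abs, sq_abs]
  simp
  linear_combination r ^ 2 * Real.sin_sq_add_cos_sq s

/-- Motion in polar coordinates along the direction field of `u A1 + (1 - u) A0`. -/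
lemma hasDerivAt_polarPoint {r σ : ℝ → ℝ} {u k t : ℝ}
    (hr : HasDerivAt r (k * radialRate u (σ t) * r t) t)
    (hσ : HasDerivAt σ (k * angularRate u (σ t)) t) :
    HasDerivAt (fun t => polarPoint (r t) (σ t))
      (k • act (u • A1 + (1 - u) • A0) (polarPoint (r t) (σ t))) t := by
  have h := Real.sin_sq_add_cos_sq (σ t)
  have hpi : HasDerivAt (fun t => (polarPoint (r t) (σ t)).ofLp)
      (k • act (u • A1 + (1 - u) • A0) (polarPoint (r t) (σ t))).ofLp t := by
    rw [hasDerivAt_pi]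
    intro i
    fin_cases i
    · refine (hr.mul hσ.cos).congr_deriv ?_
      simp [act, A0, A1, polarPoint, radialRate, angularRate]
      linear_combination k * r t *
        (-0.1 * (1 - u) * Real.cos (σ t) - (0.5 + 1.5 * u) * Real.sin (σ t)) * h
    · refine (hr.mul hσ.sin).neg.congr_deriv ?_
      simp [act, A0, A1, polarPoint, radialRate, angularRate]
      linear_combination k * r t *
        ((-2 + 1.5 * u) * Real.cos (σ t) + 0.1 * u * Real.sin (σ t)) * h
  exact (PiLp.continuousLinearEquiv 2 ℝ fun _ : Fin 2 => ℝ).symm.hasFDerivAt.comp_hasDerivAt t hpi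

/-- For every angle `S` at which the destabilizing feedback selects `A0`, some solution winds up
to the angle `S` by time `1`, with a gain exponential in `S`. -/
lemma exists_solution_of_angle {S : ℝ} (hS0 : 0 ≤ S) (hS : Real.sin (2 * S) = 1) :
    ∃ (x : ℝ → E2) (z1 z2 : ℝ → ℝ),
      IsSolution 1000 x z1 z2 ∧
      (∀ τ ∈ Icc (-2 : ℝ) 0, ‖x τ‖ ≤ 1) ∧
      (∀ τ ∈ Icc (-2 : ℝ) 0, |z1 τ| ≤ 1) ∧
      z1 0 = 0 ∧
      (∀ τ ∈ Icc (-2 : ℝ) (-1), z2 τ = 1) ∧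
      Real.exp (0.13 * S - 1.055) ≤ ‖x 1‖ := by
  -- The parameter `s` is the clockwise angle; `u` and `G` are the two controls along the orbit.
  set u : ℝ → ℝ := fun s => (1 - Real.sin (2 * min s S)) / 2 with hu
  have huc : Continuous u := by fun_prop
  have hu0 : ∀ s, 0 ≤ u s := fun s => by simp only [hu]; linarith [Real.sin_le_one (2 * min s S)]
  have hu1 : ∀ s, u s ≤ 1 := fun s => by
    simp only [hu]; linarith [Real.neg_one_le_sin (2 * min s S)]
  have huS : ∀ s, S ≤ s → u s = 0 := fun s hs => by simp [hu, min_eq_right hs, hS]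
  have huS' : ∀ s, s ≤ S → u s = (1 - Real.sin (2 * s)) / 2 := fun s hs => by
    simp [hu, min_eq_left hs]
  set G : ℝ → ℝ := fun s => max 0 (min 1 (S + 1 - s)) with hG
  have hGc : Continuous G := by fun_prop
  have hG0 : ∀ s, 0 ≤ G s := fun s => le_max_left _ _
  have hG1 : ∀ s, G s ≤ 1 := fun s => max_le zero_le_one (min_le_left _ _)
  have hGS : ∀ s, s ≤ S → G s = 1 := fun s hs => by
    simp only [hG]; rw [min_eq_left (by linarith), max_eq_right zero_le_one]
  have hGS' : ∀ s, S + 1 ≤ s → G s = 0 := fun s hs => by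
    simp only [hG]; rw [min_eq_right (by linarith), max_eq_left (by linarith)]
  have hw : ∀ s, 0.4 ≤ angularRate (u s) s := fun s => angularRate_ge (hu0 s) (hu1 s) s
  have hwc : Continuous fun s => angularRate (u s) s := by unfold angularRate; fun_prop
  have hw0 : ∀ s, angularRate (u s) s ≠ 0 := fun s =>
    ne_of_gt (by linarith [hw s])
  have hpc : Continuous fun s => radialRate (u s) s / angularRate (u s) s := by
    refine Continuous.div₀ ?_ hwc hw0
    unfold radialRate; fun_prop
  set L : ℝ → ℝ := fun s => -1 + ∫ y in (0 : ℝ)..s, radialRate (u y) y / angularRate (u y) y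
    with hL
  have hLd : ∀ s, HasDerivAt L (radialRate (u s) s / angularRate (u s) s) s := fun s =>
    (hpc.integral_hasStrictDerivAt 0 s).hasDerivAt.const_add (-1)
  have hLc : Continuous L := continuous_iff_continuousAt.2 fun s => (hLd s).continuousAt
  have hL0 : L 0 = -1 := by simp [hL]
  have hmono : MonotoneOn (fun s => L s - (0.13 * s - 0.055 * Real.sin (4 * s))) (Iic S) := by
    have hd : ∀ s, HasDerivAt (fun s => L s - (0.13 * s - 0.055 * Real.sin (4 * s)))
        (radialRate (u s) s / angularRate (u s) s - (0.13 - 0.22 * Real.cos (4 * s))) s := by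
      intro s
      have h4 : HasDerivAt (fun s : ℝ => 4 * s) 4 s := by
        simpa using (hasDerivAt_id s).const_mul (4 : ℝ)
      have h13 : HasDerivAt (fun s : ℝ => 0.13 * s) 0.13 s := by
        simpa using (hasDerivAt_id s).const_mul (0.13 : ℝ)
      exact ((hLd s).sub (h13.sub (h4.sin.const_mul 0.055))).congr_deriv (by ring)
    refine monotoneOn_of_hasDerivWithinAt_nonneg (convex_Iic S)
      (fun s _ => (hd s).continuousAt.continuousWithinAt) (fun s _ => (hd s).hasDerivWithinAt)
      fun s hs => ?_
    rw [huS' s (mem_Iic.1 (interior_subset hs))]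
    exact sub_nonneg.2 (le_radialRate_div_angularRate s)
  have hL_ge : ∀ s, 0 ≤ s → s ≤ S → 0.13 * s - 1.055 ≤ L s := fun s h0 h1 => by
    have := hmono (mem_Iic.2 hS0) (mem_Iic.2 h1) h0
    simp [hL0] at this
    linarith [Real.sin_le_one (4 * s)]
  have hL_le : ∀ s, s ≤ 0 → L s ≤ 0 := fun s h0 => by
    have := hmono (mem_Iic.2 (h0.trans hS0)) (mem_Iic.2 hS0) h0
    simp [hL0] at this
    linarith [Real.neg_one_le_sin (4 * s)]
  -- The time law of the angle.
  set m : ℝ → ℝ := fun s => 1000 * (1 + G s * Real.exp (L s) ^ 2) with hm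
  have hmc : Continuous m := by fun_prop
  have hm1 : ∀ s, 1000 ≤ m s := fun s => by
    have := mul_nonneg (hG0 s) (sq_nonneg (Real.exp (L s)))
    simp only [hm]; linarith
  have hbound : ∃ K, ∀ s, m s ≤ K := by
    obtain ⟨K, hK⟩ := (isCompact_Icc (a := (0 : ℝ)) (b := S + 1)).bddAbove_image hmc.continuousOn
    refine ⟨max K 2000, fun s => ?_⟩
    rcases le_total s 0 with h0 | h0
    · refine le_max_of_le_right ?_
      have h1 : Real.exp (L s) ≤ 1 := Real.exp_le_one_iff.2 (hL_le s h0)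
      have h2 : G s * Real.exp (L s) ^ 2 ≤ 1 :=
        mul_le_one₀ (hG1 s) (by positivity) (pow_le_one₀ (Real.exp_pos _).le h1)
      simp only [hm]; linarith
    rcases le_total s (S + 1) with h1 | h1
    · exact le_max_of_le_left (hK (mem_image_of_mem _ ⟨h0, h1⟩))
    · refine le_max_of_le_right ?_
      simp only [hm]; rw [hGS' s h1]; norm_num
  obtain ⟨K, hK⟩ := hbound
  obtain ⟨σ, hσ1, hσ⟩ := exists_global_solution (h := fun s => m s * angularRate (u s) s)
    (hmc.mul hwc) (fun s => mul_pos (by linarith [hm1 s]) (by linarith [hw s])) (H := K * 3)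
    (fun s => mul_le_mul (hK s) (angularRate_le (hu0 s) (hu1 s) s) (by linarith [hw s])
      (by linarith [hm1 s, hK s])) 1 S
  have hσc : Continuous σ := continuous_iff_continuousAt.2 fun s => (hσ s).continuousAt
  have hσm : Monotone fun t => σ t - t := by
    refine monotone_of_hasDerivAt_nonneg (fun t => (hσ t).sub (hasDerivAt_id t)) fun t => ?_
    have := mul_le_mul (hm1 (σ t)) (hw (σ t)) (by norm_num) (by linarith [hm1 (σ t)])
    simp only [Pi.zero_apply]
    linarith
  have hσmono : Monotone σ := fun a b hab => by have := hσm hab; simp only at this; linarith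
  have hσS : ∀ t, t ≤ 1 → σ t ≤ S := fun t ht => hσ1 ▸ hσmono ht
  have hσS' : ∀ t, 1 ≤ t → S ≤ σ t := fun t ht => hσ1 ▸ hσmono ht
  have hσ2 : ∀ t, 2 ≤ t → S + 1 ≤ σ t := fun t ht => by
    have := hσm (show (1 : ℝ) ≤ t by linarith)
    simp only [hσ1] at this; linarith
  have hσ0 : σ 0 ≤ 0 := by
    by_contra! hpos
    have hd : ∀ t, HasDerivAt (fun t => -Real.exp (-0.26 * σ t) - t)
        (0.26 * Real.exp (-0.26 * σ t) * (m (σ t) * angularRate (u (σ t)) (σ t)) - 1) t := fun t =>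
      ((((hσ t).const_mul (-0.26)).exp.neg).sub (hasDerivAt_id t)).congr_deriv (by ring)
    have hmon : MonotoneOn (fun t => -Real.exp (-0.26 * σ t) - t) (Icc 0 1) := by
      refine monotoneOn_of_hasDerivWithinAt_nonneg (convex_Icc 0 1)
        (fun t _ => (hd t).continuousAt.continuousWithinAt) (fun t _ => (hd t).hasDerivWithinAt)
        fun t ht => ?_
      obtain ⟨ht0, ht1⟩ := interior_subset ht
      have h1 := hL_ge (σ t) (hpos.le.trans (hσmono ht0)) (hσS t ht1)
      have h2 : Real.exp (-2.11) * Real.exp (0.26 * σ t) ≤ Real.exp (L (σ t)) ^ 2 := by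
        rw [← Real.exp_add, ← Real.exp_nat_mul]
        exact Real.exp_le_exp.2 (by push_cast; linarith)
      have h3 : 1000 * (Real.exp (-2.11) * Real.exp (0.26 * σ t)) ≤ m (σ t) := by
        simp only [hm]; rw [hGS _ (hσS t ht1)]; linarith
      have h4 : 1000 * (Real.exp (-2.11) * Real.exp (0.26 * σ t)) * 0.4 ≤
          m (σ t) * angularRate (u (σ t)) (σ t) :=
        mul_le_mul h3 (hw _) (by norm_num) (by linarith [hm1 (σ t)])
      have h5 : Real.exp (-0.26 * σ t) * Real.exp (0.26 * σ t) = 1 := by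
        rw [← Real.exp_add]; simp
      have h6 : 1 / 27 ≤ Real.exp (-2.11) := by
        have h7 : Real.exp 2.11 ≤ 27 := by
          calc Real.exp 2.11 ≤ Real.exp 1 ^ 3 := by
                rw [← Real.exp_nat_mul]; exact Real.exp_le_exp.2 (by norm_num)
            _ ≤ 3 ^ 3 := by gcongr; linarith [Real.exp_one_lt_d9]
            _ = 27 := by norm_num
        rw [Real.exp_neg, one_div]
        exact inv_anti₀ (Real.exp_pos _) h7
      have h8 := mul_le_mul_of_nonneg_left h4
        (show 0 ≤ 0.26 * Real.exp (-0.26 * σ t) by positivity)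
      have h9 : 0.26 * Real.exp (-0.26 * σ t) *
          (1000 * (Real.exp (-2.11) * Real.exp (0.26 * σ t)) * 0.4) = 104 * Real.exp (-2.11) := by
        linear_combination 104 * Real.exp (-2.11) * h5
      linarith
    have h := hmon (left_mem_Icc.2 zero_le_one) (right_mem_Icc.2 zero_le_one) zero_le_one
    have h' : Real.exp (-0.26 * σ 0) < 1 := Real.exp_zero ▸ Real.exp_lt_exp.2 (by linarith)
    simp only at h
    linarith [Real.exp_pos (-0.26 * σ 1)]
  have hx : ∀ t, ‖polarPoint (Real.exp (L (σ t))) (σ t)‖ = Real.exp (L (σ t)) := fun t =>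
    norm_polarPoint (Real.exp_pos _).le _
  have hxd : ∀ t, HasDerivAt (fun t => polarPoint (Real.exp (L (σ t))) (σ t))
      (m (σ t) • act (u (σ t) • A1 + (1 - u (σ t)) • A0)
        (polarPoint (Real.exp (L (σ t))) (σ t))) t := fun t => by
    refine hasDerivAt_polarPoint (((hLd (σ t)).comp t (hσ t)).exp.congr_deriv ?_) (hσ t)
    have := hw0 (σ t)
    simp only [Function.comp_apply]
    field_simp
  refine ⟨fun t => polarPoint (Real.exp (L (σ t))) (σ t), fun t => u (σ (t + 1)),
    fun t => G (σ (t + 2)), ⟨?_, ?_, ?_, fun t ht => ⟨?_, ?_, ?_⟩⟩, ?_, ?_, ?_, ?_, ?_⟩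
  · exact fun t _ => (hxd t).continuousAt.continuousWithinAt
  · exact Continuous.continuousOn (by fun_prop)
  · exact Continuous.continuousOn (by fun_prop)
  · refine (hxd t).congr_deriv ?_
    simp only [sub_add_cancel]
    rw [gfun, hx, phi_of_mem (hG0 _) (hG1 _), phi_of_mem (hu0 _) (hu1 _), smul_smul]
    rcases le_total t 1 with h1 | h1
    · simp only [hm]
      simp [hGS _ (hσS t h1)]
    · rw [huS _ (hσS' t h1)]
      simp only [zero_smul, sub_zero, one_smul, zero_add, hm]
      rw [← add_smul]
      congr 1
      ring
  · have hz : u (σ (t + 1)) = 0 := huS _ (hσS' _ (by linarith))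
    simp only [hz, neg_zero]
    refine (hasDerivAt_const t (0 : ℝ)).congr_of_eventuallyEq ?_
    filter_upwards [Ioi_mem_nhds ht] with y hy
    exact huS _ (hσS' _ (by linarith [mem_Ioi.1 hy]))
  · have hz : G (σ (t + 2)) = 0 := hGS' _ (hσ2 _ (by linarith))
    simp only [hz, neg_zero]
    refine (hasDerivAt_const t (0 : ℝ)).congr_of_eventuallyEq ?_
    filter_upwards [Ioi_mem_nhds ht] with y hy
    exact hGS' _ (hσ2 _ (by linarith [mem_Ioi.1 hy]))
  · intro t ht
    simp only [hx]
    exact Real.exp_le_one_iff.2 (hL_le _ ((hσmono ht.2).trans hσ0))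
  · intro t _
    exact abs_le.2 ⟨by linarith [hu0 (σ (t + 1))], hu1 _⟩
  · exact huS _ (hσS' _ (by norm_num))
  · exact fun t ht => hGS _ (hσS _ (by linarith [ht.2]))
  · simp only [hσ1, norm_polarPoint (Real.exp_pos _).le]
    exact Real.exp_le_exp.2 (hL_ge S hS0 le_rfl)

/-- Lemma 1 (arbitrarily large transients): there is `c > 0` such that for every `M > 0`
there is a solution of `(S_c)` with `sup_{τ∈[-2,0]} |x(τ)| ≤ 1`, `sup_{τ∈[-2,0]} |z1(τ)| ≤ 1`,
`z1(0) = 0`, `z2 ≡ 1` on `[-2,-1]`, and `|x(1)| ≥ 2M`. -/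
theorem stmt_0 :
    ∃ c : ℝ, 0 < c ∧ ∀ M : ℝ, 0 < M →
      ∃ (x : ℝ → E2) (z1 z2 : ℝ → ℝ),
        IsSolution c x z1 z2 ∧
        (∀ τ ∈ Icc (-2 : ℝ) 0, ‖x τ‖ ≤ 1) ∧
        (∀ τ ∈ Icc (-2 : ℝ) 0, |z1 τ| ≤ 1) ∧
        z1 0 = 0 ∧
        (∀ τ ∈ Icc (-2 : ℝ) (-1), z2 τ = 1) ∧
        2 * M ≤ ‖x 1‖ := by
  refine ⟨1000, by norm_num, fun M hM => ?_⟩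
  obtain ⟨n, hn⟩ := exists_nat_ge ((2 * M + 1.055) / 0.13)
  have hpi := Real.pi_pos
  have hn' : (n : ℝ) ≤ Real.pi / 4 + n * Real.pi := by
    nlinarith [Real.pi_gt_three, Nat.cast_nonneg (α := ℝ) n]
  have hS : Real.sin (2 * (Real.pi / 4 + n * Real.pi)) = 1 := by
    rw [show 2 * (Real.pi / 4 + n * Real.pi) = Real.pi / 2 + n * (2 * Real.pi) by ring,
      Real.sin_add_nat_mul_two_pi, Real.sin_pi_div_two]
  obtain ⟨x, z1, z2, hsol, hx, hz1, hz10, hz2, hx1⟩ :=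
    exists_solution_of_angle (by positivity) hS
  refine ⟨x, z1, z2, hsol, hx, hz1, hz10, hz2, le_trans ?_ hx1⟩
  rw [div_le_iff₀ (by norm_num)] at hn
  linarith [Real.add_one_le_exp (0.13 * (Real.pi / 4 + n * Real.pi) - 1.055)]
end

section
/- There exists c > 0 such that for every M > 0 there exists a solution X of the time-delay system (S_c) with initial segment satisfying ‖X0‖ ≤ 2 and with sup_{t∈[0,1]} |X(t)| ≥ M. Consequently, the system (S_c) does not have bounded reachability sets (is not BRS): the reachable set from the ball of radius 2 over the time interval [0,1] is unbounded. -/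
open Set Matrix

/-- Angular speed, up to sign, of the flow of the mixed matrix with weights `(1 ± κ) / 2` at the
point `(cos s, -sin s)`. -/
noncomputable def angularSpeed (s κ : ℝ) : ℝ :=
  1.25 - 0.75 * κ * Real.cos (2 * s) - 0.05 * κ * Real.sin (2 * s)

/-- Radial growth rate of the flow of the mixed matrix with weights `(1 ± κ) / 2` at the
point `(cos s, -sin s)`. -/
noncomputable def radialSpeed (s κ : ℝ) : ℝ :=
  -0.75 * κ * Real.sin (2 * s) - 0.05 * (1 - κ * Real.cos (2 * s))

/-- The feedback follows `-sin (2 s)` up to time `S`, and is frozen afterwards. -/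
noncomputable def feedback (S s : ℝ) : ℝ := -Real.sin (2 * min s S)

/-- Logarithm of the radius along the trajectory with feedback `feedback S`. -/
noncomputable def logRadius (S s : ℝ) : ℝ :=
  ∫ τ in (0 : ℝ)..s, radialSpeed τ (feedback S τ) / angularSpeed τ (feedback S τ)

/-- The trajectory with feedback `feedback S`, parametrized by its angle. -/
noncomputable def spiral (S s : ℝ) : E2 :=
  !₂[Real.exp (logRadius S s) * Real.cos s, -(Real.exp (logRadius S s) * Real.sin s)]

/-- Continuous cutoff, equal to `1` up to `S` and to `0` after `S + 1`. -/
noncomputable def cutoff (S s : ℝ) : ℝ := max 0 (min 1 (S + 1 - s))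

/-- Density of physical time with respect to the angle. -/
noncomputable def timeDensity (c S s : ℝ) : ℝ :=
  1 / (angularSpeed s (feedback S s) *
    (c * (1 + cutoff S s * Real.exp (2 * logRadius S s))))

lemma feedback_mem (S s : ℝ) : feedback S s ∈ Icc (-1 : ℝ) 1 := by
  unfold feedback
  exact ⟨by linarith [Real.sin_le_one (2 * min s S)],
    by linarith [Real.neg_one_le_sin (2 * min s S)]⟩

lemma angularSpeed_mem (s : ℝ) {κ : ℝ} (hκ : κ ∈ Icc (-1 : ℝ) 1) :
    angularSpeed s κ ∈ Icc (1 / 3 : ℝ) 3 := by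
  have h1 : |κ * Real.cos (2 * s)| ≤ 1 := by
    rw [abs_mul]
    exact mul_le_one₀ (abs_le.2 hκ) (abs_nonneg _) (Real.abs_cos_le_one _)
  have h2 : |κ * Real.sin (2 * s)| ≤ 1 := by
    rw [abs_mul]
    exact mul_le_one₀ (abs_le.2 hκ) (abs_nonneg _) (Real.abs_sin_le_one _)
  rw [abs_le] at h1 h2
  unfold angularSpeed
  constructor <;> nlinarith [h1.1, h1.2, h2.1, h2.2]

lemma angularSpeed_feedback_pos (S s : ℝ) : 0 < angularSpeed s (feedback S s) := by
  linarith [(angularSpeed_mem s (feedback_mem S s)).1]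

lemma continuous_feedback (S : ℝ) : Continuous (feedback S) := by
  unfold feedback; fun_prop

lemma continuous_cutoff (S : ℝ) : Continuous (cutoff S) := by
  unfold cutoff; fun_prop

lemma continuous_angularSpeed_feedback (S : ℝ) :
    Continuous fun s => angularSpeed s (feedback S s) := by
  have := continuous_feedback S
  unfold angularSpeed; fun_prop

lemma hasDerivAt_logRadius (S s : ℝ) :
    HasDerivAt (logRadius S)
      (radialSpeed s (feedback S s) / angularSpeed s (feedback S s)) s := by
  have h0 := continuous_feedback S
  have h1 : Continuous fun s => radialSpeed s (feedback S s) := by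
    unfold radialSpeed; fun_prop
  have h2 : Continuous fun τ => radialSpeed τ (feedback S τ) / angularSpeed τ (feedback S τ) :=
    h1.div (continuous_angularSpeed_feedback S) fun s => (angularSpeed_feedback_pos S s).ne'
  exact (h2.integral_hasStrictDerivAt 0 s).hasDerivAt

lemma continuous_logRadius (S : ℝ) : Continuous (logRadius S) :=
  continuous_iff_continuousAt.2 fun s => (hasDerivAt_logRadius S s).continuousAt

lemma norm_spiral_sq (S s : ℝ) : ‖spiral S s‖ ^ 2 = Real.exp (2 * logRadius S s) := by
  rw [EuclideanSpace.real_norm_sq_eq]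
  simp only [spiral, Fin.sum_univ_two]
  simp only [cons_val_zero, cons_val_one]
  rw [two_mul, Real.exp_add]
  linear_combination (Real.exp (logRadius S s)) ^ 2 * Real.sin_sq_add_cos_sq s

lemma norm_spiral (S s : ℝ) : ‖spiral S s‖ = Real.exp (logRadius S s) := by
  have h := norm_spiral_sq S s
  rw [two_mul, Real.exp_add, ← sq] at h
  exact (sq_eq_sq₀ (norm_nonneg _) (Real.exp_pos _).le).1 h

lemma hasDerivAt_vec {a b : ℝ → ℝ} {a' b' s : ℝ} (ha : HasDerivAt a a' s)
    (hb : HasDerivAt b b' s) :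
    HasDerivAt (fun s => (!₂[a s, b s] : E2)) !₂[a', b'] s := by
  have key : ∀ u v : ℝ, (!₂[u, v] : E2) = u • !₂[1, 0] + v • !₂[0, 1] := by
    intro u v
    ext i
    fin_cases i <;> simp
  rw [key, funext fun s => key (a s) (b s)]
  exact (ha.smul_const _).add (hb.smul_const _)

lemma act_mix (q : ℝ) (a b : ℝ) :
    act (q • A1 + (1 - q) • A0) !₂[a, b] =
      !₂[-0.1 * (1 - q) * a + (0.5 + 1.5 * q) * b, (1.5 * q - 2) * a - 0.1 * q * b] := by
  ext i
  fin_cases i <;>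
    simp [act, A0, A1, Matrix.toLpLin_apply] <;> ring

lemma hasDerivAt_spiral (S s : ℝ) :
    HasDerivAt (spiral S) ((angularSpeed s (feedback S s))⁻¹ •
      act (((1 + feedback S s) / 2) • A1 + (1 - (1 + feedback S s) / 2) • A0) (spiral S s)) s := by
  have hR := (hasDerivAt_logRadius S s).exp
  have h := hasDerivAt_vec (hR.mul (Real.hasDerivAt_cos s)) (hR.mul (Real.hasDerivAt_sin s)).neg
  have hD := (angularSpeed_feedback_pos S s).ne'
  refine h.congr_deriv ?_
  unfold spiral
  rw [act_mix]
  generalize feedback S s = κ at *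
  generalize Real.exp (logRadius S s) = r at *
  have e1 := Real.sin_sq_add_cos_sq s
  ext i
  fin_cases i
  · simp
    field_simp
    unfold radialSpeed angularSpeed
    rw [Real.sin_two_mul, Real.cos_two_mul]
    linear_combination 0.2 * r * κ * Real.cos s * e1
  · simp
    field_simp
    unfold radialSpeed angularSpeed
    rw [Real.sin_two_mul, Real.cos_two_mul]
    linear_combination 3 * r * κ * Real.cos s * e1

lemma logRadius_lower {S s : ℝ} (h0 : 0 ≤ s) (hs : s ≤ S) : 0.1 * s - 0.1 ≤ logRadius S s := by
  let G : ℝ → ℝ := fun s => 0.1 * s - 0.075 * Real.sin (4 * s) + 0.0125 * Real.cos (4 * s)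
  have hG : ∀ s, HasDerivAt G (0.1 - 0.3 * Real.cos (4 * s) - 0.05 * Real.sin (4 * s)) s := by
    intro s
    have h4 : HasDerivAt (fun s : ℝ => 4 * s) 4 s := by
      simpa using (hasDerivAt_id s).const_mul (4 : ℝ)
    have := (((hasDerivAt_id s).const_mul (0.1 : ℝ)).sub (h4.sin.const_mul 0.075)).add
      (h4.cos.const_mul 0.0125)
    exact this.congr_deriv (by ring)
  have hd : ∀ s, HasDerivAt (fun s => logRadius S s - G s) _ s := fun s =>
    (hasDerivAt_logRadius S s).sub (hG s)
  have hmono : MonotoneOn (fun s => logRadius S s - G s) (Icc 0 S) := by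
    refine monotoneOn_of_deriv_nonneg (convex_Icc _ _)
      (fun x _ => (hd x).continuousAt.continuousWithinAt)
      (fun x _ => (hd x).differentiableAt.differentiableWithinAt) ?_
    intro x hx
    rw [interior_Icc] at hx
    rw [(hd x).deriv, sub_nonneg, le_div_iff₀ (angularSpeed_feedback_pos S x)]
    have hc : feedback S x = -Real.sin (2 * x) := by
      rw [feedback, min_eq_left hx.2.le]
    rw [hc]
    unfold angularSpeed radialSpeed
    have h4 : 4 * x = 2 * (2 * x) := by ring
    rw [h4, Real.cos_two_mul (2 * x), Real.sin_two_mul (2 * x)]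
    have e := Real.sin_sq_add_cos_sq (2 * x)
    generalize Real.sin (2 * x) = u at *
    generalize Real.cos (2 * x) = v at *
    have hP1 : -(1 / 2) ≤ u * v := by nlinarith [sq_nonneg (u + v)]
    have hP2 : u * v ≤ 1 / 2 := by nlinarith [sq_nonneg (u - v)]
    have hW0 : 0 ≤ u ^ 2 := sq_nonneg u
    have hW1 : u ^ 2 ≤ 1 := by nlinarith [sq_nonneg v]
    have hv : v ^ 2 = 1 - u ^ 2 := by linarith
    have e2 : 2 * u * v = 2 * (u * v) := by ring
    rw [hv, e2]
    have e3 : -0.75 * -u * u - 0.05 * (1 - -u * v) = 0.75 * u ^ 2 - 0.05 * (1 + u * v) := by ring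
    have e4 : 1.25 - 0.75 * -u * v - 0.05 * -u * u = 1.25 + 0.75 * (u * v) + 0.05 * u ^ 2 := by
      ring
    rw [e3, e4]
    generalize u * v = P at *
    generalize u ^ 2 = W at *
    nlinarith [mul_nonneg (sub_nonneg.2 hP1) hW0, mul_nonneg (sub_nonneg.2 hP2) hW0,
      mul_nonneg (sub_nonneg.2 hP1) (sub_nonneg.2 hW1),
      mul_nonneg (sub_nonneg.2 hP2) (sub_nonneg.2 hW1), sq_nonneg P,
      mul_nonneg hW0 (sub_nonneg.2 hW1)]
  have h := hmono ⟨le_rfl, h0.trans hs⟩ ⟨h0, hs⟩ h0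
  have hz : logRadius S 0 = 0 := by simp [logRadius]
  simp only [hz, G, mul_zero, Real.sin_zero, Real.cos_zero] at h
  linarith [Real.sin_le_one (4 * s), Real.neg_one_le_cos (4 * s)]

lemma exists_time_change {F : ℝ → ℝ} (hF : Continuous F) (hpos : ∀ s, 0 < F s) {δ s₁ : ℝ}
    (hδ : 0 < δ) (hle : ∀ s, s₁ ≤ s → δ ≤ F s) :
    ∃ σ : ℝ → ℝ, Continuous σ ∧ Monotone σ ∧ σ 0 = 0 ∧
      (∀ s, 0 ≤ s → σ (∫ τ in (0 : ℝ)..s, F τ) = s) ∧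
      ∀ t, 0 < t → HasDerivAt σ (F (σ t))⁻¹ t := by
  obtain ⟨ε, hε, hεle⟩ : ∃ ε, 0 < ε ∧ ∀ s, ε ≤ F (max s 0) := by
    obtain ⟨m, -, hm⟩ := isCompact_Icc.exists_isMinOn
      (nonempty_Icc.2 (le_max_right s₁ 0)) hF.continuousOn
    refine ⟨min δ (F m), lt_min hδ (hpos m), fun s => ?_⟩
    rcases le_total s₁ (max s 0) with h | h
    · exact (min_le_left _ _).trans (hle _ h)
    · exact (min_le_right _ _).trans
        (hm ⟨le_max_right _ _, h.trans (le_max_left _ _)⟩)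
  have hf : Continuous fun s => F (max s 0) := by fun_prop
  let T : ℝ → ℝ := fun s => ∫ τ in (0 : ℝ)..s, F (max τ 0)
  have hT : ∀ s, HasDerivAt T (F (max s 0)) s := fun s =>
    (hf.integral_hasStrictDerivAt 0 s).hasDerivAt
  have hT0 : T 0 = 0 := by simp [T]
  have hTmono : StrictMono T :=
    strictMono_of_deriv_pos fun s => by rw [(hT s).deriv]; exact hpos _
  have hd : ∀ s, HasDerivAt (fun s => T s - ε * s) (F (max s 0) - ε) s := fun s =>
    ((hT s).sub ((hasDerivAt_id s).const_mul ε)).congr_deriv (by rw [mul_one])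
  have hlin : Monotone fun s => T s - ε * s :=
    monotone_of_deriv_nonneg (fun s => (hd s).differentiableAt) fun s => by
      rw [(hd s).deriv]; linarith [hεle s]
  have hTcont : Continuous T := continuous_iff_continuousAt.2 fun s => (hT s).continuousAt
  have hsurj : Function.Surjective T := by
    refine hTcont.surjective ?_ ?_
    · refine Filter.tendsto_atTop_mono' _ ?_ (Filter.tendsto_id.const_mul_atTop hε)
      filter_upwards [Filter.eventually_ge_atTop 0] with s hs
      have := hlin hs
      simp only [hT0, mul_zero, id] at this ⊢
      linarith
    · refine Filter.tendsto_atBot_mono' _ ?_ (Filter.tendsto_id.const_mul_atBot hε)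
      filter_upwards [Filter.eventually_le_atBot 0] with s hs
      have := hlin hs
      simp only [hT0, mul_zero, id] at this ⊢
      linarith
  let e : ℝ ≃o ℝ := hTmono.orderIsoOfSurjective T hsurj
  have hleft : ∀ s, e.symm (T s) = s := fun s => e.symm_apply_apply s
  have hright : ∀ t, T (e.symm t) = t := fun t => e.apply_symm_apply t
  have hzero : e.symm 0 = 0 := by simpa [hT0] using hleft 0
  refine ⟨e.symm, e.symm.continuous, e.symm.monotone, hzero, fun s hs => ?_, fun t ht => ?_⟩
  · have : ∫ τ in (0 : ℝ)..s, F τ = T s := by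
      refine intervalIntegral.integral_congr fun τ hτ => ?_
      rw [uIcc_of_le hs] at hτ
      simp only [max_eq_left hτ.1]
    rw [this, hleft]
  · have hnonneg : 0 ≤ e.symm t := by
      rw [← hzero]; exact e.symm.monotone ht.le
    have h := hT (e.symm t)
    rw [max_eq_left hnonneg] at h
    exact HasDerivAt.of_local_left_inverse e.symm.continuous.continuousAt h (hpos _).ne'
      (Filter.Eventually.of_forall hright)

lemma cutoff_mem (S s : ℝ) : cutoff S s ∈ Icc (0 : ℝ) 1 :=
  ⟨le_max_left _ _, max_le zero_le_one (min_le_left _ _)⟩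

lemma cutoff_of_le {S s : ℝ} (h : s ≤ S) : cutoff S s = 1 := by
  rw [cutoff, min_eq_left (by linarith), max_eq_right zero_le_one]

lemma cutoff_of_ge {S s : ℝ} (h : S + 1 ≤ s) : cutoff S s = 0 := by
  rw [cutoff, max_eq_left ((min_le_right _ _).trans (by linarith))]

lemma feedback_of_ge {S s : ℝ} (hS : Real.sin (2 * S) = 1) (h : S ≤ s) : feedback S s = -1 := by
  rw [feedback, min_eq_right h, hS]

lemma phi_of_mem_s9 {s : ℝ} (h : s ∈ Icc (0 : ℝ) 1) : phi s = s := by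
  simp [phi, not_lt.2 h.1, h.2]

lemma timeDensity_pos {c : ℝ} (hc : 0 < c) (S s : ℝ) : 0 < timeDensity c S s := by
  have := angularSpeed_feedback_pos S s
  have := (cutoff_mem S s).1
  unfold timeDensity; positivity

lemma continuous_timeDensity {c : ℝ} (hc : 0 < c) (S : ℝ) : Continuous (timeDensity c S) := by
  have h1 := continuous_angularSpeed_feedback S
  have h2 := continuous_cutoff S
  have h3 := continuous_logRadius S
  unfold timeDensity
  refine continuous_const.div (by fun_prop) fun s => ?_
  have := angularSpeed_feedback_pos S s
  have := (cutoff_mem S s).1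
  positivity

lemma timeDensity_le {c : ℝ} (hc : 0 < c) (S s : ℝ) : timeDensity c S s ≤ 3 / c := by
  have h1 := (angularSpeed_mem s (feedback_mem S s)).1
  have h2 := (cutoff_mem S s).1
  unfold timeDensity
  rw [div_le_div_iff₀ (mul_pos (angularSpeed_feedback_pos S s) (by positivity)) hc]
  have h3 : c * 1 ≤ c * (1 + cutoff S s * Real.exp (2 * logRadius S s)) := by
    gcongr; linarith [mul_nonneg h2 (Real.exp_pos (2 * logRadius S s)).le]
  nlinarith

lemma timeDensity_le_exp {c : ℝ} (hc : 0 < c) {S s : ℝ} (h0 : 0 ≤ s) (hs : s ≤ S) :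
    timeDensity c S s ≤ 3 / c * Real.exp (0.2 - 0.2 * s) := by
  have h1 := (angularSpeed_mem s (feedback_mem S s)).1
  have h4 := logRadius_lower h0 hs
  unfold timeDensity
  rw [cutoff_of_le hs, one_mul]
  have h2 : Real.exp (0.2 - 0.2 * s) = (Real.exp (-(0.2 - 0.2 * s)))⁻¹ := by
    rw [Real.exp_neg, inv_inv]
  have h3 : Real.exp (-(0.2 - 0.2 * s)) ≤ 1 + Real.exp (2 * logRadius S s) := by
    have : Real.exp (-(0.2 - 0.2 * s)) ≤ Real.exp (2 * logRadius S s) :=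
      Real.exp_le_exp.2 (by linarith)
    linarith
  have h5 : 3 / c * (Real.exp (-(0.2 - 0.2 * s)))⁻¹ =
      1 / (1 / 3 * (c * Real.exp (-(0.2 - 0.2 * s)))) := by
    field_simp
  rw [h2, h5]
  gcongr

lemma timeDensity_ge {c : ℝ} (hc : 0 < c) {S s : ℝ} (h : S + 1 ≤ s) :
    1 / (3 * c) ≤ timeDensity c S s := by
  have h1 := (angularSpeed_mem s (feedback_mem S s)).2
  have h2 := angularSpeed_feedback_pos S s
  unfold timeDensity
  rw [cutoff_of_ge h, zero_mul, add_zero, mul_one]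
  gcongr

lemma integral_timeDensity_le {c : ℝ} (hc : 0 < c) {S : ℝ} (hS : 0 ≤ S) :
    ∫ τ in (0 : ℝ)..(S + 1), timeDensity c S τ ≤ 48 / c := by
  have hint : ∀ a b : ℝ, IntervalIntegrable (timeDensity c S) MeasureTheory.volume a b :=
    fun a b => (continuous_timeDensity hc S).intervalIntegrable a b
  have hcont : Continuous fun τ : ℝ => 3 / c * Real.exp (0.2 - 0.2 * τ) := by fun_prop
  have hprim : ∀ s : ℝ, HasDerivAt (fun τ : ℝ => -(15 / c * Real.exp (0.2 - 0.2 * τ)))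
      (3 / c * Real.exp (0.2 - 0.2 * s)) s := fun s => by
    have h : HasDerivAt (fun τ : ℝ => 0.2 - 0.2 * τ) (-0.2) s := by
      simpa using ((hasDerivAt_id s).const_mul (0.2 : ℝ)).const_sub 0.2
    exact (h.exp.const_mul (15 / c)).neg.congr_deriv (by ring)
  have h1 : ∫ τ in (0 : ℝ)..S, timeDensity c S τ ≤ 45 / c := by
    calc ∫ τ in (0 : ℝ)..S, timeDensity c S τ
        ≤ ∫ τ in (0 : ℝ)..S, 3 / c * Real.exp (0.2 - 0.2 * τ) :=
          intervalIntegral.integral_mono_on hS (hint _ _) (hcont.intervalIntegrable _ _)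
            fun τ hτ => timeDensity_le_exp hc hτ.1 hτ.2
      _ = -(15 / c * Real.exp (0.2 - 0.2 * S)) - -(15 / c * Real.exp (0.2 - 0.2 * 0)) :=
          intervalIntegral.integral_eq_sub_of_hasDerivAt (fun s _ => hprim s)
            (hcont.intervalIntegrable _ _)
      _ ≤ 15 / c * 3 := by
          have h2 : Real.exp (0.2 - 0.2 * 0) ≤ 3 :=
            (Real.exp_le_exp.2 (by norm_num)).trans (Real.exp_one_lt_d9.le.trans (by norm_num))
          have h3 : 0 ≤ 15 / c * Real.exp (0.2 - 0.2 * S) := by positivity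
          have h4 : 15 / c * Real.exp (0.2 - 0.2 * 0) ≤ 15 / c * 3 := by gcongr
          linarith
      _ = 45 / c := by ring
  have h2 : ∫ τ in S..(S + 1), timeDensity c S τ ≤ 3 / c := by
    calc ∫ τ in S..(S + 1), timeDensity c S τ ≤ ∫ _ in S..(S + 1), 3 / c :=
          intervalIntegral.integral_mono_on (by linarith) (hint _ _)
            (continuous_const.intervalIntegrable _ _) fun τ _ => timeDensity_le hc S τ
      _ = 3 / c := by simp
  rw [← intervalIntegral.integral_add_adjacent_intervals (hint 0 S) (hint S (S + 1))]
  calc _ ≤ 45 / c + 3 / c := add_le_add h1 h2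
    _ = 48 / c := by ring

lemma exists_switching_angle (L : ℝ) : ∃ S, 0 ≤ S ∧ L ≤ S ∧ Real.sin (2 * S) = 1 := by
  obtain ⟨n, hn⟩ := exists_nat_ge L
  refine ⟨Real.pi / 4 + n * Real.pi, by positivity, ?_, ?_⟩
  · nlinarith [Real.pi_gt_three, (Nat.cast_nonneg n : (0 : ℝ) ≤ n)]
  · rw [show 2 * (Real.pi / 4 + n * Real.pi) = Real.pi / 2 + n * (2 * Real.pi) by ring,
      Real.sin_add_nat_mul_two_pi, Real.sin_pi_div_two]

/-- When the cutoff is strictly between `0` and `1`, only `A0` is active, so the vector field of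
`(S_c)` is parallel to the velocity of the spiral. -/
lemma velocity_eq {c : ℝ} (hc : 0 < c) {S : ℝ} (hS : Real.sin (2 * S) = 1) (s : ℝ) :
    (timeDensity c S s)⁻¹ • (angularSpeed s (feedback S s))⁻¹ •
        act (((1 + feedback S s) / 2) • A1 + (1 - (1 + feedback S s) / 2) • A0) (spiral S s) =
      (c * cutoff S s) • (1 + ‖spiral S s‖ ^ 2) •
        act (((1 + feedback S s) / 2) • A1 + (1 - (1 + feedback S s) / 2) • A0) (spiral S s) +
      (c * (1 - cutoff S s)) • act A0 (spiral S s) := by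
  have hD := (angularSpeed_feedback_pos S s).ne'
  have hscal : (timeDensity c S s)⁻¹ * (angularSpeed s (feedback S s))⁻¹ =
      c * (1 + cutoff S s * ‖spiral S s‖ ^ 2) := by
    rw [timeDensity, norm_spiral_sq, one_div, inv_inv]
    field_simp
  rw [smul_smul, hscal, smul_smul]
  rcases le_total s S with h | h
  · rw [cutoff_of_le h]; simp
  · rw [feedback_of_ge hS h]
    simp only [add_neg_cancel, zero_div, zero_smul, sub_zero, one_smul, zero_add]
    rw [← add_smul]
    congr 1
    ring

/-- `(S_c)` is not BRS: there is `c > 0` such that for every `M > 0` some solution with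
`‖X0‖ ≤ 2` reaches norm at least `M` on the time interval `[0,1]`. -/
theorem stmt_9 :
    ∃ c : ℝ, 0 < c ∧ ∀ M : ℝ, 0 < M →
      ∃ (x : ℝ → E2) (z1 z2 : ℝ → ℝ),
        IsSolution c x z1 z2 ∧ initNorm x z1 z2 ≤ 2 ∧
        ∃ t ∈ Icc (0 : ℝ) 1, M ≤ Xnorm x z1 z2 t := by
  refine ⟨100, by norm_num, fun M hM => ?_⟩
  have hc : (0 : ℝ) < 100 := by norm_num
  obtain ⟨S, hS0, hSL, hS⟩ := exists_switching_angle (10 * Real.log M + 1)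
  have hFcont := continuous_timeDensity hc S
  have hFpos := timeDensity_pos hc S
  obtain ⟨σ, hσc, hσm, hσ0, hσinv, hσd⟩ :=
    exists_time_change hFcont hFpos (s₁ := S + 1)
      (by norm_num : (0 : ℝ) < 1 / (3 * 100)) fun s hs => timeDensity_ge hc hs
  have hT1 : ∫ τ in (0 : ℝ)..(S + 1), timeDensity 100 S τ ≤ 1 :=
    (integral_timeDensity_le hc hS0).trans (by norm_num)
  have hTS0 : 0 ≤ ∫ τ in (0 : ℝ)..S, timeDensity 100 S τ :=
    intervalIntegral.integral_nonneg hS0 fun τ _ => (hFpos τ).le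
  have hTS1 : ∫ τ in (0 : ℝ)..S, timeDensity 100 S τ ≤ 1 := by
    refine le_trans ?_ hT1
    rw [← intervalIntegral.integral_add_adjacent_intervals (hFcont.intervalIntegrable 0 S)
      (hFcont.intervalIntegrable S (S + 1))]
    exact le_add_of_nonneg_right
      (intervalIntegral.integral_nonneg (by linarith) fun τ _ => (hFpos τ).le)
  have hσ1 : ∀ t, 1 ≤ t → S + 1 ≤ σ t := fun t ht => by
    rw [← hσinv (S + 1) (by linarith)]
    exact hσm (hT1.trans ht)
  have hspiral : Continuous (spiral S) :=
    continuous_iff_continuousAt.2 fun s => (hasDerivAt_spiral S s).continuousAt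
  have hfb := continuous_feedback S
  have hcut := continuous_cutoff S
  let x : ℝ → E2 := fun t => spiral S (σ (max t 0))
  let z1 : ℝ → ℝ := fun t => (1 + feedback S (σ (max (t + 1) 0))) / 2
  let z2 : ℝ → ℝ := fun t => cutoff S (σ (max (t + 2) 0))
  have hz1mem : ∀ t, z1 t ∈ Icc (0 : ℝ) 1 := fun t => by
    have h := feedback_mem S (σ (max (t + 1) 0))
    exact ⟨by simp only [z1]; linarith [h.1], by simp only [z1]; linarith [h.2]⟩
  have hz2mem : ∀ t, z2 t ∈ Icc (0 : ℝ) 1 := fun t => cutoff_mem _ _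
  have hz1 : ∀ t, 0 < t → z1 t = 0 := fun t ht => by
    simp only [z1]
    rw [feedback_of_ge hS]
    · norm_num
    · linarith [hσ1 (max (t + 1) 0) (le_max_of_le_left (by linarith))]
  have hz2 : ∀ t, 0 < t → z2 t = 0 := fun t ht =>
    cutoff_of_ge (hσ1 _ (le_max_of_le_left (by linarith)))
  have hzero : ∀ z : ℝ → ℝ, (∀ t, 0 < t → z t = 0) → ∀ t, 0 < t → HasDerivAt z (-(z t)) t := by
    intro z hz t ht
    rw [hz t ht, neg_zero]
    refine (hasDerivAt_const t (0 : ℝ)).congr_of_eventuallyEq ?_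
    filter_upwards [lt_mem_nhds ht] with s hs using hz s hs
  refine ⟨x, z1, z2, ⟨?_, ?_, ?_, fun t ht => ⟨?_, hzero z1 hz1 t ht, hzero z2 hz2 t ht⟩⟩, ?_, ?_⟩
  · exact (by fun_prop : Continuous x).continuousOn
  · exact (by fun_prop : Continuous z1).continuousOn
  · exact (by fun_prop : Continuous z2).continuousOn
  · have hxt : x t = spiral S (σ t) := by simp only [x, max_eq_left ht.le]
    have hz1t : z1 (t - 1) = (1 + feedback S (σ t)) / 2 := by
      simp only [z1, sub_add_cancel, max_eq_left ht.le]
    have hz2t : z2 (t - 2) = cutoff S (σ t) := by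
      simp only [z2, sub_add_cancel, max_eq_left ht.le]
    rw [gfun, phi_of_mem_s9 (hz1mem _), phi_of_mem_s9 (hz2mem _), hxt, hz1t, hz2t,
      ← velocity_eq hc hS]
    refine ((hasDerivAt_spiral S (σ t)).scomp t (hσd t ht)).congr_of_eventuallyEq ?_
    filter_upwards [lt_mem_nhds ht] with s hs
    simp only [x, max_eq_left hs.le, Function.comp]
  · refine Real.sSup_le ?_ (by norm_num)
    rintro _ ⟨t, ht, rfl⟩
    have hx : ‖x t‖ ^ 2 = 1 := by
      simp only [x, max_eq_right ht.2, hσ0, norm_spiral_sq]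
      simp [logRadius]
    refine Real.sqrt_le_iff.2 ⟨by norm_num, ?_⟩
    have h1 := hz1mem t
    have h2 := hz2mem t
    rw [hx]
    nlinarith [h1.1, h1.2, h2.1, h2.2]
  · refine ⟨_, ⟨hTS0, hTS1⟩, Real.le_sqrt_of_sq_le ?_⟩
    have hM' : M ≤ ‖x (∫ τ in (0 : ℝ)..S, timeDensity 100 S τ)‖ := by
      simp only [x, max_eq_left hTS0, hσinv S hS0, norm_spiral]
      rw [← Real.exp_log hM, Real.exp_le_exp]
      linarith [logRadius_lower hS0 le_rfl]
    nlinarith [sq_nonneg (z1 (∫ τ in (0 : ℝ)..S, timeDensity 100 S τ)),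
      sq_nonneg (z2 (∫ τ in (0 : ℝ)..S, timeDensity 100 S τ))]
end
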